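/- arXiv:2109.13349 — 4 statements merged into one kernel-verified Lean document; each statement's English description precedes it below -/
import Mathlib

section
/- Let J : ℝ → (real m×n matrices) be differentiable at t₀ with derivative J'(t₀), and suppose rank(J(t₀)) = m. Then the function μ(t) = sqrt(det(J(t) J(t)ᵀ)) is differentiable at t₀ with derivative μ'(t₀) = μ(t₀) · trace(J'(t₀) · J(t₀)†), where J† = Jᵀ (J Jᵀ)⁻¹ denotes the Moore–Penrose pseudoinverse of the full-row-rank matrix J. -/
open Matrix

/-- Jacobi's formula for the derivative of a determinant. -/
theorem Matrix.hasDerivAt_det {ι : Type*} [Fintype ι] [DecidableEq ι]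
    {A : ℝ → Matrix ι ι ℝ} {A' : Matrix ι ι ℝ} {t₀ : ℝ}
    (hA : ∀ i j, HasDerivAt (fun t => A t i j) (A' i j) t₀) :
    HasDerivAt (fun t => (A t).det) ((A t₀).adjugate * A').trace t₀ := by
  have hsum : HasDerivAt (fun t => ∑ σ : Equiv.Perm ι,
      ((Equiv.Perm.sign σ : ℤ) : ℝ) * ∏ i, A t (σ i) i)
      (∑ σ : Equiv.Perm ι, ((Equiv.Perm.sign σ : ℤ) : ℝ) *
        ∑ i, (∏ j ∈ Finset.univ.erase i, A t₀ (σ j) j) • A' (σ i) i) t₀ :=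
    HasDerivAt.fun_sum fun σ _ =>
      (HasDerivAt.fun_finsetProd fun i _ => hA (σ i) i).const_mul _
  simp only [det_apply']
  convert hsum using 1
  have htrace : ((A t₀).adjugate * A').trace =
      ∑ i, ((A t₀).updateCol i fun k => A' k i).det := by
    simp only [← cramer_apply, cramer_eq_adjugate_mulVec]
    rfl
  simp only [htrace, det_apply', Finset.mul_sum]
  rw [Finset.sum_comm]
  refine Finset.sum_congr rfl fun σ _ => Finset.sum_congr rfl fun i _ => ?_
  rw [← Finset.prod_erase_mul _ _ (Finset.mem_univ i), updateCol_self, smul_eq_mul]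
  congr 2
  exact Finset.prod_congr rfl fun j hj => updateCol_ne (Finset.ne_of_mem_erase hj)

theorem Matrix.det_mul_transpose_pos {ι κ : Type*} [Fintype ι] [DecidableEq ι] [Fintype κ]
    {M : Matrix ι κ ℝ} (hM : M.rank = Fintype.card ι) : 0 < (M * Mᵀ).det := by
  have hunit : IsUnit (M * Mᵀ) := by
    rw [← linearIndependent_rows_iff_isUnit, linearIndependent_iff_card_eq_finrank_span,
      Set.finrank, ← rank_eq_finrank_span_row, rank_self_mul_transpose, hM]
  have hnonneg : 0 ≤ (M * Mᵀ).det := by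
    simpa only [conjTranspose_eq_transpose_of_trivial] using
      (posSemidef_self_mul_conjTranspose M).det_nonneg
  exact hnonneg.lt_of_ne' ((isUnit_iff_isUnit_det _).mp hunit).ne_zero

theorem Matrix.hasDerivAt_mul_transpose_apply {ι κ : Type*} [Fintype κ]
    {J : ℝ → Matrix ι κ ℝ} {J' : Matrix ι κ ℝ} {t₀ : ℝ}
    (hJ : ∀ i j, HasDerivAt (fun t => J t i j) (J' i j) t₀) (i k : ι) :
    HasDerivAt (fun t => (J t * (J t)ᵀ) i k) ((J' * (J t₀)ᵀ + J t₀ * J'ᵀ) i k) t₀ := by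
  simp only [mul_apply, add_apply, transpose_apply, ← Finset.sum_add_distrib]
  exact HasDerivAt.fun_sum fun j _ => (hJ i j).mul (hJ k j)

/-- If `S` is symmetric, then `S * (M * Nᵀ + N * Mᵀ)` has trace twice that of `M * (Nᵀ * S)`. -/
theorem Matrix.IsSymm.trace_mul_mul_transpose_add {ι κ R : Type*} [Fintype ι] [Fintype κ]
    [CommRing R] {S : Matrix ι ι R} (hS : S.IsSymm) (M N : Matrix ι κ R) :
    (S * (M * Nᵀ + N * Mᵀ)).trace = 2 * (M * (Nᵀ * S)).trace := by
  have h₁ : (S * (M * Nᵀ)).trace = (M * (Nᵀ * S)).trace := by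
    rw [trace_mul_comm, Matrix.mul_assoc]
  have h₂ : (S * (N * Mᵀ)).trace = (M * (Nᵀ * S)).trace := by
    rw [← trace_transpose (M * (Nᵀ * S))]
    simp only [transpose_mul, transpose_transpose, hS.eq, Matrix.mul_assoc]
  rw [Matrix.mul_add, trace_add, h₁, h₂, two_mul]

/-- If `J : ℝ → Matrix (Fin m) (Fin n) ℝ` is (entrywise) differentiable at `t₀` with
derivative `J'`, and `J t₀` has full row rank `m`, then the manipulability index
`μ(t) = √(det (J t * (J t)ᵀ))` is differentiable at `t₀` with derivative
`μ(t₀) · trace (J' * J†)`, where `J† = Jᵀ (J Jᵀ)⁻¹` is the Moore–Penrose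
pseudoinverse of the full-row-rank matrix `J t₀`. -/
theorem manipulability_hasDerivAt
    (m n : ℕ) (J : ℝ → Matrix (Fin m) (Fin n) ℝ)
    (J' : Matrix (Fin m) (Fin n) ℝ) (t₀ : ℝ)
    (hJ : ∀ i j, HasDerivAt (fun t => J t i j) (J' i j) t₀)
    (hrank : (J t₀).rank = m) :
    HasDerivAt (fun t => Real.sqrt ((J t * (J t)ᵀ).det))
      (Real.sqrt ((J t₀ * (J t₀)ᵀ).det) *
        (J' * ((J t₀)ᵀ * (J t₀ * (J t₀)ᵀ)⁻¹)).trace) t₀ := by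
  have hpos : 0 < (J t₀ * (J t₀)ᵀ).det :=
    det_mul_transpose_pos (by rw [hrank, Fintype.card_fin])
  have hsymm : ((J t₀ * (J t₀)ᵀ)⁻¹).IsSymm := by
    rw [IsSymm, transpose_nonsing_inv, transpose_mul, transpose_transpose]
  have hadj : (J t₀ * (J t₀)ᵀ).adjugate =
      (J t₀ * (J t₀)ᵀ).det • (J t₀ * (J t₀)ᵀ)⁻¹ := by
    rw [inv_def, smul_smul, Ring.mul_inverse_cancel _ hpos.ne'.isUnit, one_smul]
  have hdet := hasDerivAt_det (hasDerivAt_mul_transpose_apply hJ)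
  rw [hadj, smul_mul, trace_smul, hsymm.trace_mul_mul_transpose_add, smul_eq_mul] at hdet
  convert hdet.sqrt hpos.ne' using 1
  have hsqrt : √(J t₀ * (J t₀)ᵀ).det ≠ 0 := (Real.sqrt_pos.mpr hpos).ne'
  rw [eq_div_iff (mul_ne_zero two_ne_zero hsqrt)]
  linear_combination 2 * (J' * ((J t₀)ᵀ * (J t₀ * (J t₀)ᵀ)⁻¹)).trace *
    Real.mul_self_sqrt hpos.le
end

section
/- (Second-order exponential CBF invariance.) Let p₁, p₂ > 0 and set α₁ = p₁ p₂ and α₂ = p₁ + p₂ (so that s² + α₂ s + α₁ has roots −p₁, −p₂). Let h : ℝ → ℝ be twice differentiable with: (i) h''(t) ≥ −α₁ h(t) − α₂ h'(t) for all t ≥ 0, (ii) h(0) ≥ 0, and (iii) h'(0) + p₁ h(0) ≥ 0. Then h(t) ≥ 0 for all t ≥ 0. -/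
/-- A differentiable function with `f' + p f ≥ 0` on `[0, ∞)` and `f 0 ≥ 0` is nonnegative on
`[0, ∞)`. -/
theorem nonneg_of_deriv_add_mul_nonneg {f : ℝ → ℝ} (p : ℝ) (hf : Differentiable ℝ f)
    (hineq : ∀ t ≥ (0 : ℝ), 0 ≤ deriv f t + p * f t) (h0 : 0 ≤ f 0) :
    ∀ t ≥ (0 : ℝ), 0 ≤ f t := by
  intro t ht
  have hderiv (x : ℝ) : HasDerivAt (fun x => Real.exp (p * x) * f x)
      (Real.exp (p * x) * (deriv f x + p * f x)) x := by
    have he : HasDerivAt (fun x => Real.exp (p * x)) (Real.exp (p * x) * p) x := by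
      simpa using ((hasDerivAt_id x).const_mul p).exp
    exact (he.mul (hf x).hasDerivAt).congr_deriv (by ring)
  have hmono : MonotoneOn (fun x => Real.exp (p * x) * f x) (Set.Ici 0) := by
    refine monotoneOn_of_deriv_nonneg (convex_Ici 0)
      (fun x _ => (hderiv x).continuousAt.continuousWithinAt)
      (fun x _ => (hderiv x).differentiableAt.differentiableWithinAt) fun x hx => ?_
    rw [(hderiv x).deriv]
    exact mul_nonneg (Real.exp_pos _).le (hineq x (interior_subset hx))
  have hle : f 0 ≤ Real.exp (p * t) * f t := by
    simpa using hmono Set.self_mem_Ici (Set.mem_Ici.2 ht) ht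
  exact nonneg_of_mul_nonneg_right (h0.trans hle) (Real.exp_pos _)


/-- Second-order exponential CBF invariance: for `p₁, p₂ > 0` with `α₁ = p₁ p₂`,
`α₂ = p₁ + p₂`, if `h : ℝ → ℝ` is twice differentiable with
`h'' t ≥ −α₁ h t − α₂ h' t` for all `t ≥ 0`, `h 0 ≥ 0`, and `h' 0 + p₁ h 0 ≥ 0`,
then `h t ≥ 0` for all `t ≥ 0`. -/
theorem ecbf_second_order_invariance
    (p₁ p₂ : ℝ) (hp₁ : 0 < p₁) (hp₂ : 0 < p₂)
    (h : ℝ → ℝ) (hdiff : Differentiable ℝ h) (hdiff' : Differentiable ℝ (deriv h))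
    (hineq : ∀ t ≥ (0 : ℝ),
      deriv (deriv h) t ≥ -(p₁ * p₂) * h t - (p₁ + p₂) * deriv h t)
    (h0 : 0 ≤ h 0) (h0' : 0 ≤ deriv h 0 + p₁ * h 0) :
    ∀ t ≥ (0 : ℝ), 0 ≤ h t := by
  refine nonneg_of_deriv_add_mul_nonneg p₁ hdiff ?_ h0
  refine nonneg_of_deriv_add_mul_nonneg (f := fun t => deriv h t + p₁ * h t) p₂
    (hdiff'.add (hdiff.const_mul p₁)) (fun t ht => ?_) h0'
  have hd : deriv (fun t => deriv h t + p₁ * h t) t = deriv (deriv h) t + p₁ * deriv h t :=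
    ((hdiff' t).hasDerivAt.add ((hdiff t).hasDerivAt.const_mul p₁)).deriv
  rw [hd]
  linarith [hineq t ht]
end

section
/- (Skew-symmetry of Λ̇ − 2ΛQJ̄.) Let J : ℝ → (real m×n matrices) and M, C : ℝ → (real n×n matrices) be functions with J and M differentiable at t₀, such that M(t₀) is symmetric positive definite, rank(J(t₀)) = m, and Ṁ(t₀) = C(t₀) + C(t₀)ᵀ. Define, at t₀: Λ = (J M⁻¹ Jᵀ)⁻¹, Q = J M⁻¹ C − J̇, and J̄ = M⁻¹ Jᵀ Λ. Then Λ(t) = (J(t) M(t)⁻¹ J(t)ᵀ)⁻¹ is differentiable at t₀ and Λ̇(t₀) = Λ Q J̄ + (Λ Q J̄)ᵀ; equivalently, the matrix Λ̇(t₀) − 2 Λ Q J̄ is skew-symmetric. -/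
open Matrix

section

attribute [local instance] Matrix.linftyOpNormedRing Matrix.linftyOpNormedAlgebra

/-- A matrix-valued function is differentiable iff all its entries are. -/
theorem Matrix.hasDerivAt_iff_entrywise {k : ℕ} {A : ℝ → Matrix (Fin k) (Fin k) ℝ}
    {A' : Matrix (Fin k) (Fin k) ℝ} {t : ℝ} :
    HasDerivAt A A' t ↔ ∀ i j, HasDerivAt (fun s => A s i j) (A' i j) t :=
  hasDerivAt_pi.trans (forall_congr' fun _ => hasDerivAt_pi)

/-- The entrywise derivative of the inverse of a matrix-valued function. -/
theorem Matrix.hasDerivAt_inv_apply {k : ℕ} {A : ℝ → Matrix (Fin k) (Fin k) ℝ}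
    {A' : Matrix (Fin k) (Fin k) ℝ} {t : ℝ}
    (hA : ∀ i j, HasDerivAt (fun s => A s i j) (A' i j) t) (hu : IsUnit (A t)) :
    ∀ i j, HasDerivAt (fun s => (A s)⁻¹ i j) ((-((A t)⁻¹ * A' * (A t)⁻¹)) i j) t := by
  obtain ⟨u, hu⟩ := hu
  have hinv : (↑u⁻¹ : Matrix (Fin k) (Fin k) ℝ) = (A t)⁻¹ := by
    rw [← hu, Matrix.coe_units_inv]
  have hd : HasFDerivAt Ring.inverse (-ContinuousLinearMap.mulLeftRight ℝ
      (Matrix (Fin k) (Fin k) ℝ) ↑u⁻¹ ↑u⁻¹) (A t) := hu ▸ hasFDerivAt_ringInverse u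
  have h := hd.comp_hasDerivAt t (Matrix.hasDerivAt_iff_entrywise.2 hA)
  simp only [Function.comp_def, ← Matrix.nonsing_inv_eq_ringInverse, hinv,
    _root_.neg_apply, ContinuousLinearMap.mulLeftRight_apply] at h
  exact Matrix.hasDerivAt_iff_entrywise.1 h

end

/-- The entrywise product rule for matrix-valued functions. -/
theorem Matrix.hasDerivAt_mul_apply {k l m : ℕ} {A : ℝ → Matrix (Fin k) (Fin l) ℝ}
    {B : ℝ → Matrix (Fin l) (Fin m) ℝ} {A' : Matrix (Fin k) (Fin l) ℝ}
    {B' : Matrix (Fin l) (Fin m) ℝ} {t : ℝ}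
    (hA : ∀ i j, HasDerivAt (fun s => A s i j) (A' i j) t)
    (hB : ∀ i j, HasDerivAt (fun s => B s i j) (B' i j) t) :
    ∀ i j, HasDerivAt (fun s => (A s * B s) i j) ((A' * B t + A t * B') i j) t := by
  intro i j
  simp only [Matrix.mul_apply, Matrix.add_apply, ← Finset.sum_add_distrib]
  exact HasDerivAt.fun_sum fun x _ => (hA i x).mul (hB x j)

/-- Skew-symmetry of `Λ̇ − 2ΛQJ̄`: with `J` and `M` (entrywise) differentiable at `t₀`,
`M t₀` symmetric positive definite, `J t₀` of full row rank `m`, and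
`Ṁ(t₀) = C t₀ + (C t₀)ᵀ`, the task-space inertia `Λ(t) = (J M⁻¹ Jᵀ)⁻¹` is
differentiable at `t₀` with `Λ̇(t₀) = ΛQJ̄ + (ΛQJ̄)ᵀ`, where `Q = J M⁻¹ C − J̇` and
`J̄ = M⁻¹ Jᵀ Λ` at `t₀`; equivalently `Λ̇(t₀) − 2ΛQJ̄` is skew-symmetric. -/
theorem task_space_inertia_deriv_skew
    (m n : ℕ) (J : ℝ → Matrix (Fin m) (Fin n) ℝ)
    (M C : ℝ → Matrix (Fin n) (Fin n) ℝ)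
    (J' : Matrix (Fin m) (Fin n) ℝ) (M' : Matrix (Fin n) (Fin n) ℝ) (t₀ : ℝ)
    (hJ : ∀ i j, HasDerivAt (fun t => J t i j) (J' i j) t₀)
    (hM : ∀ i j, HasDerivAt (fun t => M t i j) (M' i j) t₀)
    (hMpd : (M t₀).PosDef) (hMsymm : (M t₀).IsSymm)
    (hrank : (J t₀).rank = m)
    (hMC : M' = C t₀ + (C t₀)ᵀ) :
    ∀ i j, HasDerivAt (fun t => ((J t * (M t)⁻¹ * (J t)ᵀ)⁻¹) i j)
      (let Λ₀ := (J t₀ * (M t₀)⁻¹ * (J t₀)ᵀ)⁻¹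
       let Q := J t₀ * (M t₀)⁻¹ * C t₀ - J'
       let Jbar := (M t₀)⁻¹ * (J t₀)ᵀ * Λ₀
       (Λ₀ * Q * Jbar + (Λ₀ * Q * Jbar)ᵀ) i j) t₀ := by
  have hMu : IsUnit (M t₀) := hMpd.isUnit
  have hJinj : Function.Injective (J t₀).vecMul := by
    rw [Matrix.vecMul_injective_iff, linearIndependent_iff_card_eq_finrank_span, Set.finrank,
      ← Matrix.rank_eq_finrank_span_row, hrank, Fintype.card_fin]
  have hAu : IsUnit (J t₀ * (M t₀)⁻¹ * (J t₀)ᵀ) := by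
    rw [← Matrix.conjTranspose_eq_transpose_of_trivial]
    exact (hMpd.inv.mul_mul_conjTranspose_same hJinj).isUnit
  have hA := Matrix.hasDerivAt_mul_apply
    (Matrix.hasDerivAt_mul_apply hJ (Matrix.hasDerivAt_inv_apply hM hMu))
    (B := fun t => (J t)ᵀ) (B' := J'ᵀ) fun i j => hJ j i
  have hNs : ((M t₀)⁻¹)ᵀ = (M t₀)⁻¹ := by rw [Matrix.transpose_nonsing_inv, hMsymm.eq]
  have hΛs : ((J t₀ * (M t₀)⁻¹ * (J t₀)ᵀ)⁻¹)ᵀ = (J t₀ * (M t₀)⁻¹ * (J t₀)ᵀ)⁻¹ := by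
    rw [Matrix.transpose_nonsing_inv]
    simp [Matrix.transpose_mul, hNs, Matrix.mul_assoc]
  intro i j
  convert Matrix.hasDerivAt_inv_apply hA hAu i j using 1
  dsimp only
  refine Matrix.ext_iff.mpr ?_ i j
  generalize (J t₀ * (M t₀)⁻¹ * (J t₀)ᵀ)⁻¹ = L at hΛs ⊢
  simp only [hMC, Matrix.transpose_mul, Matrix.transpose_sub, Matrix.transpose_transpose, hNs, hΛs,
    Matrix.mul_add, Matrix.add_mul, Matrix.mul_sub, Matrix.sub_mul, Matrix.mul_neg, Matrix.neg_mul,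
    Matrix.mul_assoc]
  abel
end

section
/- (Passivity with respect to external disturbances, eq. (15) / Proposition 3.) Let e : ℝ → ℝᵐ be twice differentiable, let Λ : ℝ → (real symmetric m×m matrices) be differentiable, let S : ℝ → (real m×m matrices) satisfy Λ̇(t) = S(t) + S(t)ᵀ, let K_P, K_D be constant symmetric positive definite real m×m matrices, and let f_ext : ℝ → ℝᵐ be a disturbance force. Suppose the closed-loop error dynamics satisfy Λ(t) ë(t) = −S(t) ė(t) − K_P e(t) − K_D ė(t) + f_ext(t) for all t. Then the storage function V(t) = (1/2) ėᵀ Λ ė + (1/2) eᵀ K_P e satisfies V̇(t) = −ė(t)ᵀ K_D ė(t) + ė(t)ᵀ f_ext(t) ≤ ė(t)ᵀ f_ext(t) for all t; i.e., the closed-loop system is passive with input f_ext and output ė. -/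
open Matrix

theorem HasDerivAt.dotProduct_vec {n : Type*} [Fintype n] {u v : ℝ → n → ℝ} {u' v' : n → ℝ} {t : ℝ}
    (hu : HasDerivAt u u' t) (hv : HasDerivAt v v' t) :
    HasDerivAt (fun s => u s ⬝ᵥ v s) (u' ⬝ᵥ v t + u t ⬝ᵥ v') t := by
  rw [hasDerivAt_pi] at hu hv
  simp only [dotProduct, ← Finset.sum_add_distrib]
  exact HasDerivAt.fun_sum fun i _ => (hu i).mul (hv i)

theorem HasDerivAt.matrix_mulVec {m n : Type*} [Fintype m] [Fintype n] {A : ℝ → Matrix m n ℝ}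
    {A' : Matrix m n ℝ} {v : ℝ → n → ℝ} {v' : n → ℝ} {t : ℝ}
    (hA : ∀ i j, HasDerivAt (fun s => A s i j) (A' i j) t) (hv : HasDerivAt v v' t) :
    HasDerivAt (fun s => A s *ᵥ v s) (A' *ᵥ v t + A t *ᵥ v') t :=
  hasDerivAt_pi.2 fun i => (hasDerivAt_pi.2 (hA i)).dotProduct_vec hv

theorem Matrix.IsSymm.dotProduct_mulVec_comm {n : Type*} [Fintype n] {A : Matrix n n ℝ}
    (hA : A.IsSymm) (u v : n → ℝ) : u ⬝ᵥ A *ᵥ v = v ⬝ᵥ A *ᵥ u := by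
  rw [dotProduct_mulVec, ← mulVec_transpose, hA.eq, dotProduct_comm]

/-- Derivative of a time-varying quadratic form whose matrix is symmetric at the given time. -/
theorem HasDerivAt.quadraticForm {n : Type*} [Fintype n] {A : ℝ → Matrix n n ℝ}
    {A' : Matrix n n ℝ} {v : ℝ → n → ℝ} {v' : n → ℝ} {t : ℝ} (hsymm : (A t).IsSymm)
    (hA : ∀ i j, HasDerivAt (fun s => A s i j) (A' i j) t) (hv : HasDerivAt v v' t) :
    HasDerivAt (fun s => v s ⬝ᵥ A s *ᵥ v s) (v t ⬝ᵥ A' *ᵥ v t + 2 * (v t ⬝ᵥ A t *ᵥ v')) t := by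
  convert hv.dotProduct_vec (hv.matrix_mulVec hA) using 1
  rw [dotProduct_add, hsymm.dotProduct_mulVec_comm v' (v t)]
  ring

theorem Matrix.dotProduct_add_transpose_mulVec_self {n : Type*} [Fintype n] (S : Matrix n n ℝ)
    (v : n → ℝ) : v ⬝ᵥ (S + Sᵀ) *ᵥ v = 2 * (v ⬝ᵥ S *ᵥ v) := by
  rw [add_mulVec, dotProduct_add, mulVec_transpose, dotProduct_comm v (v ᵥ* S),
    ← dotProduct_mulVec]
  ring

/-- Passivity with respect to external disturbances (eq. (15) / Proposition 3):
if the closed-loop error dynamics satisfy `Λ ë = −S ė − K_P e − K_D ė + f_ext` with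
`Λ̇ = S + Sᵀ` and `K_P`, `K_D` symmetric positive definite, then the storage function
`V = (1/2) ėᵀ Λ ė + (1/2) eᵀ K_P e` satisfies
`V̇ = −ėᵀ K_D ė + ėᵀ f_ext ≤ ėᵀ f_ext`; i.e., the closed-loop system is passive with
input `f_ext` and output `ė`. -/
theorem passivity_wrt_disturbance
    (m : ℕ) (e e' e'' : ℝ → Fin m → ℝ) (fext : ℝ → Fin m → ℝ)
    (Λ Λ' S : ℝ → Matrix (Fin m) (Fin m) ℝ)
    (KP KD : Matrix (Fin m) (Fin m) ℝ)
    (he : ∀ t, HasDerivAt e (e' t) t)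
    (he' : ∀ t, HasDerivAt e' (e'' t) t)
    (hΛsymm : ∀ t, (Λ t).IsSymm)
    (hΛ : ∀ t i j, HasDerivAt (fun s => Λ s i j) (Λ' t i j) t)
    (hS : ∀ t, Λ' t = S t + (S t)ᵀ)
    (hKP : KP.IsSymm) (hKPpd : KP.PosDef)
    (hKD : KD.IsSymm) (hKDpd : KD.PosDef)
    (hdyn : ∀ t, Λ t *ᵥ e'' t = -(S t *ᵥ e' t) - KP *ᵥ e t - KD *ᵥ e' t + fext t) :
    ∀ t : ℝ,
      HasDerivAt
        (fun s => (1 / 2) * (e' s ⬝ᵥ (Λ s *ᵥ e' s)) + (1 / 2) * (e s ⬝ᵥ (KP *ᵥ e s)))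
        (-(e' t ⬝ᵥ (KD *ᵥ e' t)) + e' t ⬝ᵥ fext t) t ∧
      -(e' t ⬝ᵥ (KD *ᵥ e' t)) + e' t ⬝ᵥ fext t ≤ e' t ⬝ᵥ fext t := by
  intro t
  constructor
  · have hkin := HasDerivAt.quadraticForm (hΛsymm t) (hΛ t) (he' t)
    have hpot := HasDerivAt.quadraticForm (A := fun _ => KP) (A' := 0) hKP
      (fun i j => hasDerivAt_const t (KP i j)) (he t)
    refine ((hkin.const_mul (1 / 2)).fun_add (hpot.const_mul (1 / 2))).congr_deriv ?_
    rw [hS, dotProduct_add_transpose_mulVec_self, hdyn, zero_mulVec, dotProduct_zero,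
      hKP.dotProduct_mulVec_comm (e t)]
    simp only [dotProduct_add, dotProduct_sub, dotProduct_neg]
    ring
  · have hdiss : 0 ≤ e' t ⬝ᵥ KD *ᵥ e' t := by
      simpa using hKDpd.posSemidef.dotProduct_mulVec_nonneg (e' t)
    linarith
end
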